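/- For every constant C ∈ ℕ there exists c > 0 such that the following holds. Let m ≥ 1 and let S₀,…,S_m be disjoint subsets of ℤ² with #S_j ≤ 2^j. Let j⃗ = (j₁,j₂,j₃,j₄) ∈ {0,…,m}⁴ and a⃗ = (a₁,a₂,a₃,a₄) ∈ ℕ⁴ with 1 ≤ a₁ < j₁/2 + C. Then #𝒬⁰(j⃗,a⃗) ≤ c · 2^{2j₁ − 2a₁ + a₂ + a₄}. -/

import Mathlib

open scoped BigOperators

noncomputable section

/-- Points of the integer lattice `ℤ²`. -/
abbrev Pt := ℤ × ℤ

/-- A quadruple of lattice points, viewed as a function on `Fin 4`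
(indices taken cyclically). -/
abbrev Quad := Fin 4 → Pt

/-- The embedding `ℤ² ↪ ℝ²`. -/
def emb (ξ : Pt) : ℝ × ℝ := ((ξ.1 : ℝ), (ξ.2 : ℝ))

/-- An affine line in the plane `ℝ²`. -/
def IsLine (ℓ : Set (ℝ × ℝ)) : Prop :=
  ∃ p v : ℝ × ℝ, v ≠ 0 ∧ ℓ = {x | ∃ t : ℝ, x = p + t • v}

/-- The line through two lattice points `p ≠ q` (a degenerate point if `p = q`). -/
def lineThrough (p q : Pt) : Set (ℝ × ℝ) :=
  {x | ∃ t : ℝ, x = emb p + t • (emb q - emb p)}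

/-- The number of points of a finite set `T ⊂ ℤ²` on a set `ℓ ⊂ ℝ²`,
i.e. `#(ℓ ∩ T)`. -/
def lineCount (ℓ : Set (ℝ × ℝ)) (T : Finset Pt) : ℕ :=
  (ℓ ∩ (emb '' (T : Set Pt))).ncard

/-- `Q = (ξ₁,ξ₂,ξ₃,ξ₄)` is a parallelogram: `ξ₁ + ξ₃ = ξ₂ + ξ₄`. -/
def IsPara (Q : Quad) : Prop := Q 0 + Q 2 = Q 1 + Q 3

/-- The dot product `(ξ₁ − ξ₂)·(ξ₁ − ξ₄)`. -/
def dotQ (Q : Quad) : ℤ :=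
  ((Q 0).1 - (Q 1).1) * ((Q 0).1 - (Q 3).1) + ((Q 0).2 - (Q 1).2) * ((Q 0).2 - (Q 3).2)

/-- `τ_Q = ||ξ₁|² − |ξ₂|² + |ξ₃|² − |ξ₄|²| = 2|(ξ₁−ξ₂)·(ξ₁−ξ₄)|`. -/
def tauQ (Q : Quad) : ℤ := 2 * |dotQ Q|

/-- `Q` is a rectangle: a parallelogram with `τ_Q = 0`. Membership in `𝒬⁰`. -/
def IsRect (Q : Quad) : Prop := IsPara Q ∧ dotQ Q = 0

/-- `f(Q) = f(ξ₁)f(ξ₂)f(ξ₃)f(ξ₄)`. -/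
def fQ (f : Pt → ℝ) (Q : Quad) : ℝ := ∏ k : Fin 4, f (Q k)

/-- The weight `f = ∑_{j=0}^m λ_j 2^{−j/2} χ_{S_j}`. -/
def fWt (S : ℕ → Finset Pt) (lam : ℕ → ℝ) (m : ℕ) (ξ : Pt) : ℝ :=
  ∑ j ∈ Finset.range (m + 1), if ξ ∈ S j then lam j * (2 : ℝ) ^ (-(j : ℝ) / 2) else 0

/-- `gcd((a,b)) = gcd(|a|,|b|)` for `(a,b) ∈ ℤ²`. -/
def gcdP (ξ : Pt) : ℕ := Int.gcd ξ.1 ξ.2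

/-- `max{#(ℓ(ξ,η₁) ∩ S_j), #(ℓ(ξ,η₂) ∩ S_j)}`, where `η₁, η₂` are the two
neighboring vertices of `ξ` in a rectangle. -/
def crossMax (S : ℕ → Finset Pt) (j : ℕ) (ξ η₁ η₂ : Pt) : ℕ :=
  max (lineCount (lineThrough ξ η₁) (S j)) (lineCount (lineThrough ξ η₂) (S j))

/-- `ξ` lies in some `S_j`, `j ≤ m`, and is a vertex of type `α ∈ {1,2,3}`
relative to its neighbors `η₁, η₂`: with `a := log₂ crossMax`, type 1 means
`a ≥ j/2 + C` (i.e. `crossMax ≥ 2^{j/2+C}`), type 2 means `1 ≤ a < j/2 + C`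
(i.e. `2 ≤ crossMax < 2^{j/2+C}`), and type 3 means `a = 0` (`crossMax = 1`). -/
def VertexType (S : ℕ → Finset Pt) (C m : ℕ) (α : ℕ) (ξ η₁ η₂ : Pt) : Prop :=
  ∃ j ≤ m, ξ ∈ S j ∧
    ((α = 1 ∧ (2 : ℝ) ^ ((j : ℝ) / 2 + (C : ℝ)) ≤ (crossMax S j ξ η₁ η₂ : ℝ)) ∨
     (α = 2 ∧ 2 ≤ crossMax S j ξ η₁ η₂ ∧
        (crossMax S j ξ η₁ η₂ : ℝ) < (2 : ℝ) ^ ((j : ℝ) / 2 + (C : ℝ))) ∨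
     (α = 3 ∧ crossMax S j ξ η₁ η₂ = 1))

/-- The set `𝒬⁰_{α,β}`: rectangles with four distinct vertices, all in
`∪_{j=0}^m S_j`, with `ξ₁, ξ₂` of type `α` and `ξ₃, ξ₄` of type `β`. -/
def QZeroAB (S : ℕ → Finset Pt) (C m : ℕ) (α β : ℕ) : Set Quad :=
  {Q | IsRect Q ∧ Function.Injective Q ∧
    VertexType S C m α (Q 0) (Q 1) (Q 3) ∧
    VertexType S C m α (Q 1) (Q 2) (Q 0) ∧
    VertexType S C m β (Q 2) (Q 3) (Q 1) ∧
    VertexType S C m β (Q 3) (Q 0) (Q 2)}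

/-- The set `𝒬⁰(j⃗, a⃗)`: rectangles with distinct vertices `ξ_k ∈ S_{j_k}` such
that for each `k` (cyclically), `2^{a_k} ≤ max{#(ℓ(ξ_k,ξ_{k+1}) ∩ S_{j_k}),
#(ℓ(ξ_k,ξ_{k−1}) ∩ S_{j_k})} < 2^{a_k+1}`. -/
def QZeroJA (S : ℕ → Finset Pt) (j a : Fin 4 → ℕ) : Set Quad :=
  {Q | IsRect Q ∧ Function.Injective Q ∧ (∀ k, Q k ∈ S (j k)) ∧
    ∀ k : Fin 4,
      2 ^ (a k) ≤ max (lineCount (lineThrough (Q k) (Q (k + 1))) (S (j k)))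
          (lineCount (lineThrough (Q k) (Q (k - 1))) (S (j k))) ∧
        max (lineCount (lineThrough (Q k) (Q (k + 1))) (S (j k)))
          (lineCount (lineThrough (Q k) (Q (k - 1))) (S (j k))) < 2 ^ (a k + 1)}


/-- A non-vertical segment in the plane: the part of the line
`y = slope * x + icept` over the interval `[lo, hi]`. -/
structure Seg where
  slope : ℝ
  icept : ℝ
  lo : ℝ
  hi : ℝ

namespace Seg

/-- The height of the line supporting `e` over the abscissa `x`. -/
def val (e : Seg) (x : ℝ) : ℝ := e.slope * x + e.icept

/-- The left endpoint. -/
def left (e : Seg) : ℝ × ℝ := (e.lo, e.val e.lo)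

/-- The right endpoint. -/
def right (e : Seg) : ℝ × ℝ := (e.hi, e.val e.hi)

/-- Two distinct segments cross if their relative interiors meet. -/
def Crosses (e f : Seg) : Prop :=
  e ≠ f ∧ ∃ x, e.lo < x ∧ f.lo < x ∧ x < e.hi ∧ x < f.hi ∧ e.val x = f.val x

lemma val_le_of_not_crosses {e f : Seg} (h : ¬ e.Crosses f) {x y : ℝ} (hxy : x < y)
    (hex : e.lo ≤ x) (hfx : f.lo ≤ x) (hey : y ≤ e.hi) (hfy : y ≤ f.hi)
    (hlt : e.val x < f.val x) : e.val y ≤ f.val y := by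
  by_contra! hy
  refine h ⟨?_, ?_⟩
  · rintro rfl
    exact lt_irrefl _ hlt
  · have hc : ContinuousOn (fun t => e.val t - f.val t) (Set.Icc x y) := by
      unfold val
      fun_prop
    obtain ⟨t, ht, h0⟩ := intermediate_value_Ioo hxy.le hc
      (show (0 : ℝ) ∈ Set.Ioo _ _ from ⟨by linarith, by linarith⟩)
    exact ⟨t, by linarith [ht.1], by linarith [ht.1], by linarith [ht.2], by linarith [ht.2],
      by simpa [sub_eq_zero] using h0⟩

lemma val_eq_of_left_eq {e f : Seg} (h : e.left = f.left) (x : ℝ) :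
    f.val x - e.val x = (f.slope - e.slope) * (x - e.lo) := by
  have h1 : e.lo = f.lo := congrArg Prod.fst h
  have h2 : e.val e.lo = f.val f.lo := congrArg Prod.snd h
  unfold val at *
  rw [← h1] at h2
  linear_combination -h2

lemma val_lt_val_of_left_eq {e f : Seg} (h : e.left = f.left) (hs : e.slope < f.slope) {x : ℝ}
    (hx : e.lo < x) : e.val x < f.val x := by
  have h1 := val_eq_of_left_eq h x
  have h2 := mul_pos (sub_pos.2 hs) (sub_pos.2 hx)
  linarith

lemma eq_of_left_eq_of_slope_eq {e f : Seg} (h : ¬ e.Crosses f) (he : e.lo < e.hi)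
    (hf : f.lo < f.hi) (hl : e.left = f.left) (hs : e.slope = f.slope) : e = f := by
  by_contra hne
  have h1 : e.lo = f.lo := congrArg Prod.fst hl
  obtain ⟨x, hx1, hx2⟩ := exists_between (lt_min he (h1 ▸ hf))
  refine h ⟨hne, x, hx1, h1 ▸ hx1, (lt_min_iff.1 hx2).1, (lt_min_iff.1 hx2).2, ?_⟩
  have := val_eq_of_left_eq hl x
  rw [hs] at this
  linarith

/-- `f` is the successor of `e` in the fan, ordered by slope, of the segments of `E` with the same
left endpoint, and `v` is a leftmost point of `V` in the wedge between `e` and `f`. -/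
structure IsWedge (E : Finset Seg) (V : Finset (ℝ × ℝ)) (e f : Seg) (v : ℝ × ℝ) : Prop where
  mem_left : e ∈ E
  mem_right : f ∈ E
  left_eq : e.left = f.left
  slope_lt : e.slope < f.slope
  slope_le : ∀ g ∈ E, e.left = g.left → e.slope < g.slope → f.slope ≤ g.slope
  mem : v ∈ V
  lo_lt : e.lo < v.1
  le_hi : v.1 ≤ e.hi
  le_hi' : v.1 ≤ f.hi
  val_le : e.val v.1 ≤ v.2
  le_val : v.2 ≤ f.val v.1
  le_of_mem : ∀ w ∈ V, e.lo < w.1 → w.1 ≤ e.hi → w.1 ≤ f.hi → e.val w.1 ≤ w.2 →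
    w.2 ≤ f.val w.1 → v.1 ≤ w.1

lemma IsWedge.lo_eq {E V e f v} (h : IsWedge E V e f v) : e.lo = f.lo :=
  congrArg Prod.fst h.left_eq

lemma IsWedge.val_lt {E V e f v} (h : IsWedge E V e f v) {x : ℝ} (hx : e.lo < x) :
    e.val x < f.val x :=
  val_lt_val_of_left_eq h.left_eq h.slope_lt hx

lemma exists_isWedge {E : Finset Seg} {V : Finset (ℝ × ℝ)}
    (hlt : ∀ e ∈ E, e.lo < e.hi) (hr : ∀ e ∈ E, e.right ∈ V) {e : Seg} (he : e ∈ E)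
    (htop : ∃ f ∈ E, e.left = f.left ∧ e.slope < f.slope) :
    ∃ p : Seg × (ℝ × ℝ), IsWedge E V e p.1 p.2 := by
  classical
  obtain ⟨f, hf, hmin⟩ := (E.filter fun f => e.left = f.left ∧ e.slope < f.slope).exists_min_image
    (fun f => f.slope) (by
      obtain ⟨f, hf, h⟩ := htop
      exact ⟨f, Finset.mem_filter.2 ⟨hf, h⟩⟩)
  rw [Finset.mem_filter] at hf
  obtain ⟨hfE, hl, hs⟩ := hf
  have hlo : e.lo = f.lo := congrArg Prod.fst hl
  have hlt_val : ∀ x, e.lo < x → e.val x < f.val x := fun x hx => val_lt_val_of_left_eq hl hs hx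
  obtain ⟨v, hv, hvmin⟩ := (V.filter fun v => e.lo < v.1 ∧ v.1 ≤ e.hi ∧ v.1 ≤ f.hi ∧
      e.val v.1 ≤ v.2 ∧ v.2 ≤ f.val v.1).exists_min_image (fun v => v.1) (by
    rcases le_total e.hi f.hi with h | h
    · exact ⟨e.right, Finset.mem_filter.2 ⟨hr e he, hlt e he, le_rfl, h, le_rfl,
        (hlt_val _ (hlt e he)).le⟩⟩
    · have hlo' : e.lo < f.hi := hlo ▸ hlt f hfE
      exact ⟨f.right, Finset.mem_filter.2 ⟨hr f hfE, hlo', h, le_rfl,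
        (hlt_val _ hlo').le, le_rfl⟩⟩)
  rw [Finset.mem_filter] at hv
  obtain ⟨hvV, h1, h2, h3, h4, h5⟩ := hv
  exact ⟨(f, v), he, hfE, hl, hs, fun g hg hgl hgs => hmin g (Finset.mem_filter.2 ⟨hg, hgl, hgs⟩),
    hvV, h1, h2, h3, h4, h5, fun w hw w1 w2 w3 w4 w5 =>
      hvmin w (Finset.mem_filter.2 ⟨hw, w1, w2, w3, w4, w5⟩)⟩

lemma IsWedge.left_eq_left {E V e e' f f' v} (hl : ∀ e ∈ E, e.left ∈ V)
    (hnc : ∀ e ∈ E, ∀ f ∈ E, ¬ e.Crosses f)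
    (h : IsWedge E V e e' v) (h' : IsWedge E V f f' v)
    (h1 : e.val v.1 < f'.val v.1) (h2 : f.val v.1 < e'.val v.1) (hle : e.lo ≤ f.lo) :
    e.left = f.left := by
  have hfv := h'.lo_lt
  have hfl : f'.val f.lo = f.val f.lo := by
    have := congrArg Prod.snd h'.left_eq
    simp only [left] at this
    rw [this, h'.lo_eq]
  have a1 : e.val f.lo ≤ f.val f.lo := by
    by_contra! hlt
    exact absurd (val_le_of_not_crosses (hnc f' h'.mem_right e h.mem_left) hfv h'.lo_eq.ge hle
      h'.le_hi' h.le_hi (hfl ▸ hlt)) (not_le.2 h1)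
  have a2 : f.val f.lo ≤ e'.val f.lo := by
    by_contra! hlt
    exact absurd (val_le_of_not_crosses (hnc e' h.mem_right f h'.mem_left) hfv
      (h.lo_eq ▸ hle) le_rfl h.le_hi' h'.le_hi hlt) (not_le.2 h2)
  rcases hle.lt_or_eq with hlt | heq
  · have := h.le_of_mem f.left (hl f h'.mem_left) hlt (hfv.le.trans h.le_hi)
      (hfv.le.trans h.le_hi') a1 a2
    exact absurd hfv (not_lt.2 this)
  · have hel : e'.val e.lo = e.val e.lo := by
      have := congrArg Prod.snd h.left_eq
      simp only [left] at this
      rw [this, h.lo_eq]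
    refine Prod.ext heq ?_
    simp only [left]
    rw [← heq] at a1 a2 ⊢
    linarith

lemma IsWedge.eq {E V e e' f f' v} (hlt : ∀ e ∈ E, e.lo < e.hi) (hl : ∀ e ∈ E, e.left ∈ V)
    (hnc : ∀ e ∈ E, ∀ f ∈ E, ¬ e.Crosses f)
    (h : IsWedge E V e e' v) (h' : IsWedge E V f f' v)
    (hiff : e.val v.1 = v.2 ↔ f.val v.1 = v.2) : e = f := by
  have h1 := h.val_lt h.lo_lt
  have h2 := h'.val_lt h'.lo_lt
  have h3 := h.val_le
  have h4 := h'.val_le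
  have h5 := h.le_val
  have h6 := h'.le_val
  have key : e.val v.1 < f'.val v.1 ∧ f.val v.1 < e'.val v.1 ∧
      (e.val v.1 = f.val v.1 ∨ (e.val v.1 < v.2 ∧ f.val v.1 < v.2)) := by
    by_cases hv : e.val v.1 = v.2
    · have hv' := hiff.1 hv
      exact ⟨by linarith, by linarith, Or.inl (by linarith)⟩
    · have hv' := fun hh => hv (hiff.2 hh)
      have := lt_of_le_of_ne h3 hv
      have := lt_of_le_of_ne h4 hv'
      exact ⟨by linarith, by linarith, Or.inr ⟨by linarith, by linarith⟩⟩
  have hleft : e.left = f.left := by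
    rcases le_total e.lo f.lo with hh | hh
    · exact h.left_eq_left hl hnc h' key.1 key.2.1 hh
    · exact (h'.left_eq_left hl hnc h key.2.1 key.1 hh).symm
  have hlo : e.lo = f.lo := congrArg Prod.fst hleft
  have hpos : 0 < v.1 - e.lo := sub_pos.2 h.lo_lt
  have hslope : e.slope = f.slope := by
    rcases lt_trichotomy e.slope f.slope with hs | hs | hs
    · have b1 := h.slope_le f h'.mem_left hleft hs
      have b2 := val_eq_of_left_eq hleft v.1
      have b3 := val_eq_of_left_eq (h.left_eq.symm.trans hleft) v.1
      rw [← h.lo_eq] at b3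
      have b4 := mul_pos (sub_pos.2 hs) hpos
      have b5 := mul_nonneg (sub_nonneg.2 b1) hpos.le
      rcases key.2.2 with hk | hk <;> linarith
    · exact hs
    · have b1 := h'.slope_le e h.mem_left hleft.symm hs
      have b2 := val_eq_of_left_eq hleft v.1
      have b3 := val_eq_of_left_eq (h'.left_eq.symm.trans hleft.symm) v.1
      rw [← h'.lo_eq, ← hlo] at b3
      have b4 := mul_pos (sub_pos.2 hs) hpos
      have b5 := mul_nonneg (sub_nonneg.2 b1) hpos.le
      rcases key.2.2 with hk | hk <;> linarith
  exact eq_of_left_eq_of_slope_eq (hnc e h.mem_left f h'.mem_left) (hlt e h.mem_left)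
    (hlt f h'.mem_left) hleft hslope

/-- A plane graph with straight non-vertical edges has at most three times as many edges as
vertices. -/
theorem card_le_of_not_crosses {E : Finset Seg} {V : Finset (ℝ × ℝ)}
    (hlt : ∀ e ∈ E, e.lo < e.hi) (hl : ∀ e ∈ E, e.left ∈ V) (hr : ∀ e ∈ E, e.right ∈ V)
    (hnc : ∀ e ∈ E, ∀ f ∈ E, ¬ e.Crosses f) : E.card ≤ 3 * V.card := by
  classical
  have hsplit := E.card_filter_add_card_filter_not
    (p := fun e => ∃ f ∈ E, e.left = f.left ∧ e.slope < f.slope)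
  have htop : (E.filter fun e => ¬ ∃ f ∈ E, e.left = f.left ∧ e.slope < f.slope).card ≤ V.card := by
    refine Finset.card_le_card_of_injOn left (fun e he => hl e (Finset.mem_filter.1 he).1) ?_
    intro e he f hf hef
    simp only [Finset.coe_filter, Set.mem_ofPred_eq, not_exists, not_and, not_lt] at he hf
    exact eq_of_left_eq_of_slope_eq (hnc e he.1 f hf.1) (hlt e he.1) (hlt f hf.1) hef
      (le_antisymm (hf.2 e he.1 hef.symm) (he.2 f hf.1 hef))
  have hwedge : (E.filter fun e => ∃ f ∈ E, e.left = f.left ∧ e.slope < f.slope).card ≤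
      (V ×ˢ (Finset.univ : Finset Bool)).card := by
    have hex : ∀ e : Seg, ∃ p : Seg × (ℝ × ℝ),
        e ∈ E.filter (fun e => ∃ f ∈ E, e.left = f.left ∧ e.slope < f.slope) →
          IsWedge E V e p.1 p.2 := fun e => by
      by_cases he : e ∈ E.filter (fun e => ∃ f ∈ E, e.left = f.left ∧ e.slope < f.slope)
      · obtain ⟨heE, hef⟩ := Finset.mem_filter.1 he
        obtain ⟨p, hp⟩ := exists_isWedge hlt hr heE hef
        exact ⟨p, fun _ => hp⟩
      · exact ⟨(e, 0), fun h => absurd h he⟩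
    choose p hp using hex
    refine Finset.card_le_card_of_injOn
      (fun e => ((p e).2, decide (e.val (p e).2.1 = (p e).2.2))) ?_ ?_
    · intro e he
      exact Finset.mem_coe.2 (Finset.mem_product.2 ⟨(hp e he).mem, Finset.mem_univ _⟩)
    · intro e he f hf hef
      simp only [Prod.mk.injEq, decide_eq_decide] at hef
      obtain ⟨h1, h2⟩ := hef
      have hf' := hp f hf
      rw [← h1] at hf' h2
      exact (hp e he).eq hlt hl hnc hf' h2
  rw [Finset.card_product, Finset.card_univ, Fintype.card_bool] at hwedge
  omega

/-- A straight-line graph drawn in the plane has at most `3 |V|` edges more than it has (ordered)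
pairs of crossing edges. -/
theorem card_le_add_card_crosses {E : Finset Seg} {V : Finset (ℝ × ℝ)} {X : Finset (Seg × Seg)}
    (hlt : ∀ e ∈ E, e.lo < e.hi) (hl : ∀ e ∈ E, e.left ∈ V) (hr : ∀ e ∈ E, e.right ∈ V)
    (hX : ∀ e ∈ E, ∀ f ∈ E, e.Crosses f → (e, f) ∈ X) : E.card ≤ 3 * V.card + X.card := by
  classical
  have hsplit := E.card_filter_add_card_filter_not (p := fun e => ∃ f ∈ E, e.Crosses f)
  have h1 : (E.filter fun e => ∃ f ∈ E, e.Crosses f).card ≤ X.card := by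
    refine (Finset.card_le_card fun e he => ?_).trans (Finset.card_image_le (f := Prod.fst))
    obtain ⟨heE, f, hf, hef⟩ := Finset.mem_filter.1 he
    exact Finset.mem_image.2 ⟨(e, f), hX e heE f hf hef, rfl⟩
  have h2 : (E.filter fun e => ¬ ∃ f ∈ E, e.Crosses f).card ≤ 3 * V.card := by
    have hsub := Finset.filter_subset (fun e => ¬ ∃ f ∈ E, e.Crosses f) E
    refine card_le_of_not_crosses (fun e he => hlt e (hsub he)) (fun e he => hl e (hsub he))
      (fun e he => hr e (hsub he)) fun e he f hf hef => ?_
    exact (Finset.mem_filter.1 he).2 ⟨f, hsub hf, hef⟩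
  omega

end Seg

section Sampling

variable {α β : Type*} [DecidableEq α]

lemma card_filter_eq_zero_mul_pow {P T : Finset α} (hT : T ⊆ P) (N : ℕ) [NeZero N] :
    (Finset.univ.filter fun ω : P → Fin N => ∀ v : P, v.1 ∈ T → ω v = 0).card * N ^ T.card =
      N ^ P.card := by
  have h : (Finset.univ.filter fun ω : P → Fin N => ∀ v : P, v.1 ∈ T → ω v = 0) =
      Fintype.piFinset fun v : P => if v.1 ∈ T then {0} else Finset.univ := by
    ext ω
    simp only [Finset.mem_filter, Finset.mem_univ, true_and, Fintype.mem_piFinset]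
    refine forall_congr' fun v => ?_
    split_ifs with hv <;> simp [hv]
  have h2 : (∏ v : P, (if v.1 ∈ T then ({0} : Finset (Fin N)) else Finset.univ).card) =
      N ^ (P \ T).card := by
    rw [Finset.prod_coe_sort P
      fun v => (if v ∈ T then ({0} : Finset (Fin N)) else Finset.univ).card]
    rw [Finset.card_eq_sum_ones, ← Finset.prod_pow_eq_pow_sum, ← Finset.prod_sdiff hT,
      Finset.prod_congr rfl (g := fun _ => N ^ 1),
      Finset.prod_congr (s₁ := T) rfl (g := fun _ => 1)]
    · simp
    · intro v hv
      simp [hv]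
    · intro v hv
      simp [(Finset.mem_sdiff.1 hv).2]
  rw [h, Fintype.card_piFinset, h2, ← pow_add, Finset.card_sdiff_add_card_eq_card hT]

lemma sum_card_filter_eq_zero_mul_pow {P : Finset α} (I : Finset β) (T : β → Finset α) (t N : ℕ)
    [NeZero N] (hT : ∀ b ∈ I, T b ⊆ P) (ht : ∀ b ∈ I, (T b).card = t) :
    (∑ ω : P → Fin N, (I.filter fun b => ∀ v : P, v.1 ∈ T b → ω v = 0).card) * N ^ t =
      I.card * N ^ P.card := by
  have := Finset.sum_card_bipartiteAbove_eq_sum_card_bipartiteBelow (s := Finset.univ) (t := I)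
    (fun (ω : P → Fin N) b => ∀ v : P, v.1 ∈ T b → ω v = 0)
  simp only [Finset.bipartiteAbove, Finset.bipartiteBelow] at this
  rw [this, Finset.sum_mul, Finset.card_eq_sum_ones I, Finset.sum_mul]
  refine Finset.sum_congr rfl fun b hb => ?_
  rw [one_mul, ← ht b hb]
  exact card_filter_eq_zero_mul_pow (hT b hb) N

end Sampling

namespace Seg

/-- The inequality behind the crossing number inequality: apply `card_le_add_card_crosses` to
a random induced subgraph in which each vertex is retained with probability `1 / N`. -/
theorem card_mul_sq_le {E : Finset Seg} {P : Finset (ℝ × ℝ)} {X : Finset (Seg × Seg)}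
    (hlt : ∀ e ∈ E, e.lo < e.hi) (hl : ∀ e ∈ E, e.left ∈ P) (hr : ∀ e ∈ E, e.right ∈ P)
    (hX : ∀ p, p ∈ X ↔ p.1 ∈ E ∧ p.2 ∈ E ∧ p.1.Crosses p.2)
    (hdisj : ∀ e ∈ E, ∀ f ∈ E, e.Crosses f →
      e.left ≠ f.left ∧ e.left ≠ f.right ∧ e.right ≠ f.left ∧ e.right ≠ f.right)
    (N : ℕ) [NeZero N] :
    E.card * N ^ 2 ≤ 3 * P.card * N ^ 3 + X.card := by
  classical
  have hne : ∀ e ∈ E, e.left ≠ e.right := fun e he h =>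
    (hlt e he).ne (congrArg Prod.fst h)
  let TE : Seg → Finset (ℝ × ℝ) := fun e => {e.left, e.right}
  let TX : Seg × Seg → Finset (ℝ × ℝ) := fun p => {p.1.left, p.1.right, p.2.left, p.2.right}
  have hE := sum_card_filter_eq_zero_mul_pow (P := P) E TE 2 N
    (fun e he => by simp [TE, Finset.insert_subset_iff, hl e he, hr e he])
    (fun e he => Finset.card_pair (hne e he))
  have hP := sum_card_filter_eq_zero_mul_pow (P := P) P (fun v => {v}) 1 N
    (fun v hv => by simpa using hv) (fun v hv => by simp)
  have hXs := sum_card_filter_eq_zero_mul_pow (P := P) X TX 4 N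
    (fun p hp => by
      obtain ⟨h1, h2, -⟩ := (hX p).1 hp
      simp [TX, Finset.insert_subset_iff, hl _ h1, hr _ h1, hl _ h2, hr _ h2])
    (fun p hp => by
      obtain ⟨h1, h2, h3⟩ := (hX p).1 hp
      obtain ⟨a, b, c, d⟩ := hdisj _ h1 _ h2 h3
      have := hne _ h1
      have := hne _ h2
      simp only [TX]
      rw [Finset.card_insert_of_notMem, Finset.card_insert_of_notMem, Finset.card_pair] <;>
        simp [*])
  have hω : ∀ ω : P → Fin N,
      (E.filter fun e => ∀ v : P, v.1 ∈ TE e → ω v = 0).card ≤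
        3 * (P.filter fun w => ∀ v : P, v.1 ∈ ({w} : Finset (ℝ × ℝ)) → ω v = 0).card +
          (X.filter fun p => ∀ v : P, v.1 ∈ TX p → ω v = 0).card := fun ω => by
    refine card_le_add_card_crosses (fun e he => hlt e (Finset.mem_filter.1 he).1)
      (fun e he => ?_) (fun e he => ?_) fun e he f hf hef => ?_
    · obtain ⟨he, h⟩ := Finset.mem_filter.1 he
      refine Finset.mem_filter.2 ⟨hl e he, fun v hv => h v ?_⟩
      rw [Finset.mem_singleton.1 hv]
      simp [TE]
    · obtain ⟨he, h⟩ := Finset.mem_filter.1 he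
      refine Finset.mem_filter.2 ⟨hr e he, fun v hv => h v ?_⟩
      rw [Finset.mem_singleton.1 hv]
      simp [TE]
    · obtain ⟨he, h⟩ := Finset.mem_filter.1 he
      obtain ⟨hf, h'⟩ := Finset.mem_filter.1 hf
      refine Finset.mem_filter.2 ⟨(hX _).2 ⟨he, hf, hef⟩, fun v hv => ?_⟩
      simp only [TX, Finset.mem_insert, Finset.mem_singleton] at hv
      simp only [TE, Finset.mem_insert, Finset.mem_singleton] at h h'
      rcases hv with hv | hv | hv | hv
      exacts [h v (Or.inl hv), h v (Or.inr hv), h' v (Or.inl hv), h' v (Or.inr hv)]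
  have hsum := Finset.sum_le_sum fun ω (_ : ω ∈ Finset.univ) => hω ω
  rw [Finset.sum_add_distrib, ← Finset.mul_sum] at hsum
  have hN : 0 < N ^ P.card := Nat.pow_pos (Nat.pos_of_neZero N)
  refine Nat.le_of_mul_le_mul_right ?_ hN
  have h := Nat.mul_le_mul_right (N ^ 4) hsum
  calc E.card * N ^ 2 * N ^ P.card = (E.card * N ^ P.card) * N ^ 2 := by ring
    _ ≤ 3 * N ^ 3 * (P.card * N ^ P.card) + X.card * N ^ P.card := by
      rw [← hE, ← hP, ← hXs]
      convert h using 1 <;> ring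
    _ = _ := by ring

end Seg

section Incidences

/-- The points of `P` on the line `y = ℓ.1 * x + ℓ.2`. -/
def pointsOn (P : Finset (ℝ × ℝ)) (ℓ : ℝ × ℝ) : Finset (ℝ × ℝ) :=
  P.filter fun p => p.2 = ℓ.1 * p.1 + ℓ.2

/-- The pairs of consecutive elements of a finite set of reals. -/
def consecutivePairs (A : Finset ℝ) : Finset (ℝ × ℝ) :=
  (A ×ˢ A).filter fun q => q.1 < q.2 ∧ ∀ x ∈ A, q.1 < x → q.2 ≤ x

lemma mem_consecutivePairs {A : Finset ℝ} {q : ℝ × ℝ} :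
    q ∈ consecutivePairs A ↔
      q.1 ∈ A ∧ q.2 ∈ A ∧ q.1 < q.2 ∧ ∀ x ∈ A, q.1 < x → q.2 ≤ x := by
  simp [consecutivePairs, and_assoc]

lemma card_le_card_consecutivePairs_add_one (A : Finset ℝ) :
    A.card ≤ (consecutivePairs A).card + 1 := by
  rcases A.eq_empty_or_nonempty with rfl | hA
  · simp
  have hsub : A.erase (A.max' hA) ⊆ (consecutivePairs A).image Prod.fst := by
    intro a ha
    obtain ⟨hne, haA⟩ := Finset.mem_erase.1 ha
    obtain ⟨b, hb, hmin⟩ := (A.filter fun x => a < x).exists_min_image id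
      ⟨A.max' hA, Finset.mem_filter.2 ⟨A.max'_mem hA, lt_of_le_of_ne (A.le_max' a haA) hne⟩⟩
    obtain ⟨hbA, hab⟩ := Finset.mem_filter.1 hb
    exact Finset.mem_image.2 ⟨(a, b), mem_consecutivePairs.2 ⟨haA, hbA, hab,
      fun x hx hax => hmin x (Finset.mem_filter.2 ⟨hx, hax⟩)⟩, rfl⟩
  have h1 := (Finset.card_le_card hsub).trans Finset.card_image_le
  rw [Finset.card_erase_of_mem (A.max'_mem hA)] at h1
  omega

/-- The segments joining consecutive points of `P` on the lines of `L`. -/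
def consecutiveSegs (P L : Finset (ℝ × ℝ)) : Finset Seg := by
  classical
  exact L.biUnion fun ℓ => (consecutivePairs ((pointsOn P ℓ).image Prod.fst)).image
    fun q => ⟨ℓ.1, ℓ.2, q.1, q.2⟩

lemma mem_consecutiveSegs {P L : Finset (ℝ × ℝ)} {e : Seg} :
    e ∈ consecutiveSegs P L ↔ (e.slope, e.icept) ∈ L ∧
      (e.lo, e.hi) ∈ consecutivePairs ((pointsOn P (e.slope, e.icept)).image Prod.fst) := by
  classical
  simp only [consecutiveSegs, Finset.mem_biUnion, Finset.mem_image]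
  constructor
  · rintro ⟨ℓ, hℓ, q, hq, rfl⟩
    exact ⟨hℓ, hq⟩
  · rintro ⟨h1, h2⟩
    exact ⟨_, h1, _, h2, rfl⟩

lemma mul_card_le_card_consecutiveSegs {P L : Finset (ℝ × ℝ)} {k : ℕ}
    (hL : ∀ ℓ ∈ L, k ≤ (pointsOn P ℓ).card) :
    L.card * (k - 1) ≤ (consecutiveSegs P L).card := by
  classical
  rw [consecutiveSegs, Finset.card_biUnion, ← smul_eq_mul]
  · refine Finset.card_nsmul_le_sum _ _ _ fun ℓ hℓ => ?_
    rw [Finset.card_image_of_injective]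
    · have h1 := card_le_card_consecutivePairs_add_one ((pointsOn P ℓ).image Prod.fst)
      rw [Finset.card_image_of_injOn] at h1
      · have := hL ℓ hℓ
        omega
      · intro p hp q hq hpq
        have hp' := (Finset.mem_filter.1 hp).2
        have hq' := (Finset.mem_filter.1 hq).2
        exact Prod.ext hpq (by rw [hp', hq', show p.1 = q.1 from hpq])
    · intro q q' h
      simp only [Seg.mk.injEq] at h
      exact Prod.ext h.2.2.1 h.2.2.2
  · intro ℓ _ ℓ' _ hne
    refine Finset.disjoint_left.2 fun e he he' => hne ?_
    obtain ⟨q, -, rfl⟩ := Finset.mem_image.1 he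
    obtain ⟨q', -, h⟩ := Finset.mem_image.1 he'
    simp only [Seg.mk.injEq] at h
    exact Prod.ext h.1.symm h.2.1.symm

lemma Seg.slope_eq_and_icept_eq {e f : Seg} {x y : ℝ} (hxy : x ≠ y) (hx : e.val x = f.val x)
    (hy : e.val y = f.val y) : e.slope = f.slope ∧ e.icept = f.icept := by
  unfold Seg.val at hx hy
  have h : (e.slope - f.slope) * (x - y) = 0 := by linear_combination hx - hy
  have h1 : e.slope = f.slope :=
    sub_eq_zero.1 ((mul_eq_zero.1 h).resolve_right (sub_ne_zero.2 hxy))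
  refine ⟨h1, ?_⟩
  rw [h1] at hx
  linarith

lemma eq_of_mem_consecutivePairs {A : Finset ℝ} {q q' : ℝ × ℝ} (hq : q ∈ consecutivePairs A)
    (hq' : q' ∈ consecutivePairs A) {x : ℝ} (h1 : q.1 < x) (h2 : x < q.2) (h1' : q'.1 < x)
    (h2' : x < q'.2) : q = q' := by
  obtain ⟨a, b, -, d⟩ := mem_consecutivePairs.1 hq
  obtain ⟨a', b', -, d'⟩ := mem_consecutivePairs.1 hq'
  have e1 : q.1 = q'.1 := by
    rcases lt_trichotomy q.1 q'.1 with h | h | h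
    · linarith [d _ a' h]
    · exact h
    · linarith [d' _ a h]
  exact Prod.ext e1 (le_antisymm (d _ b' (by linarith)) (d' _ b (by linarith)))

lemma eq_of_mem_consecutiveSegs {P L : Finset (ℝ × ℝ)} {e f : Seg} (he : e ∈ consecutiveSegs P L)
    (hf : f ∈ consecutiveSegs P L) (hs : e.slope = f.slope) (hi : e.icept = f.icept) {x : ℝ}
    (h1 : e.lo < x) (h2 : x < e.hi) (h1' : f.lo < x) (h2' : x < f.hi) : e = f := by
  have he' := (mem_consecutiveSegs.1 he).2
  have hf' := (mem_consecutiveSegs.1 hf).2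
  rw [hs, hi] at he'
  have h := eq_of_mem_consecutivePairs he' hf' h1 h2 h1' h2'
  cases e
  cases f
  simp_all

lemma card_crosses_consecutiveSegs_le {P L : Finset (ℝ × ℝ)} {X : Finset (Seg × Seg)}
    (hX : ∀ p ∈ X, p.1 ∈ consecutiveSegs P L ∧ p.2 ∈ consecutiveSegs P L ∧ p.1.Crosses p.2) :
    X.card ≤ L.card ^ 2 := by
  rw [sq, ← Finset.card_product]
  refine Finset.card_le_card_of_injOn
    (fun p => ((p.1.slope, p.1.icept), (p.2.slope, p.2.icept))) (fun p hp => ?_) ?_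
  · obtain ⟨h1, h2, -⟩ := hX p hp
    exact Finset.mem_coe.2 (Finset.mem_product.2
      ⟨(mem_consecutiveSegs.1 h1).1, (mem_consecutiveSegs.1 h2).1⟩)
  · intro p hp q hq hpq
    simp only [Prod.mk.injEq] at hpq
    obtain ⟨⟨s1, i1⟩, s2, i2⟩ := hpq
    obtain ⟨p1, p2, hne, x, x1, x2, x3, x4, hx⟩ := hX p hp
    obtain ⟨q1, q2, -, y, y1, y2, y3, y4, hy⟩ := hX q hq
    have hxy : x = y := by
      by_contra hxy
      have hy' : p.1.val y = p.2.val y := by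
        simpa only [Seg.val, s1, i1, s2, i2] using hy
      obtain ⟨hs, hi⟩ := Seg.slope_eq_and_icept_eq hxy hx hy'
      exact hne (eq_of_mem_consecutiveSegs p1 p2 hs hi x1 x3 x2 x4)
    subst hxy
    exact Prod.ext (eq_of_mem_consecutiveSegs p1 q1 s1 i1 x1 x3 y1 y3)
      (eq_of_mem_consecutiveSegs p2 q2 s2 i2 x2 x4 y2 y4)

/-- **Szemerédi–Trotter theorem**, in the form of a bound for the number of `k`-rich (non-vertical)
lines. -/
theorem card_rich_lines_mul_pow_three_le {P L : Finset (ℝ × ℝ)} {k M D : ℕ} (hk : 2 ≤ k)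
    (hL : ∀ ℓ ∈ L, k ≤ (pointsOn P ℓ).card) (hP : P.card ≤ M) (hD : k ^ 2 ≤ D * M) :
    L.card * k ^ 3 ≤ 2304 * D * M ^ 2 := by
  classical
  have hD0 : 1 ≤ D := Nat.pos_of_ne_zero fun h => by
    rw [h, zero_mul] at hD
    have := Nat.pow_le_pow_left hk 2
    omega
  have hM0 : 1 ≤ M := Nat.pos_of_ne_zero fun h => by
    rw [h, mul_zero] at hD
    have := Nat.pow_le_pow_left hk 2
    omega
  set E := consecutiveSegs P L with hE
  have hcard : L.card * k ≤ 2 * E.card := by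
    have h1 := mul_card_le_card_consecutiveSegs hL
    calc L.card * k ≤ L.card * (2 * (k - 1)) := Nat.mul_le_mul_left _ (by omega)
      _ = 2 * (L.card * (k - 1)) := by ring
      _ ≤ _ := Nat.mul_le_mul_left _ h1
  rcases lt_or_ge E.card (6 * M) with hsmall | hbig
  · calc L.card * k ^ 3 = (L.card * k) * k ^ 2 := by ring
      _ ≤ (2 * (6 * M)) * (D * M) := Nat.mul_le_mul (by omega) hD
      _ = 12 * (D * M ^ 2) := by ring
      _ ≤ 2304 * (D * M ^ 2) := Nat.mul_le_mul_right _ (by norm_num)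
      _ = _ := by ring
  have hlt : ∀ e ∈ E, e.lo < e.hi := fun e he =>
    (mem_consecutivePairs.1 (mem_consecutiveSegs.1 he).2).2.2.1
  have hmem : ∀ (e : Seg) (x : ℝ), x ∈ (pointsOn P (e.slope, e.icept)).image Prod.fst →
      (x, e.val x) ∈ P := fun e x hx => by
    obtain ⟨p, hp, rfl⟩ := Finset.mem_image.1 hx
    obtain ⟨hpP, hpe⟩ := Finset.mem_filter.1 hp
    have : (p.1, e.val p.1) = p := Prod.ext rfl hpe.symm
    rwa [this]
  let X := (E ×ˢ E).filter fun p => p.1.Crosses p.2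
  have hX : ∀ p, p ∈ X ↔ p.1 ∈ E ∧ p.2 ∈ E ∧ p.1.Crosses p.2 := fun p => by
    simp [X, and_assoc]
  have hXcard : X.card ≤ L.card ^ 2 := card_crosses_consecutiveSegs_le fun p hp => (hX p).1 hp
  have hdisj : ∀ e ∈ E, ∀ f ∈ E, e.Crosses f →
      e.left ≠ f.left ∧ e.left ≠ f.right ∧ e.right ≠ f.left ∧ e.right ≠ f.right := by
    intro e he f hf hef
    obtain ⟨hne, x, x1, x2, x3, x4, hx⟩ := hef
    have key : ∀ y z, x ≠ y → (y, e.val y) ≠ (z, f.val z) := fun y z hxy h => by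
      obtain ⟨rfl, h2⟩ := Prod.mk.inj h
      obtain ⟨hs, hi⟩ := Seg.slope_eq_and_icept_eq hxy hx h2
      exact hne (eq_of_mem_consecutiveSegs he hf hs hi x1 x3 x2 x4)
    exact ⟨key _ _ x1.ne', key _ _ x1.ne', key _ _ x3.ne, key _ _ x3.ne⟩
  obtain ⟨N, hN⟩ : ∃ N, N = E.card / (6 * M) := ⟨_, rfl⟩
  have hN1 : 1 ≤ N := hN ▸ (Nat.one_le_div_iff (by omega)).2 hbig
  have hN2 : 6 * M * N ≤ E.card := hN ▸ Nat.mul_div_le _ _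
  have hN3 : E.card ≤ 12 * M * N := by
    have h1 := Nat.lt_mul_div_succ E.card (show 0 < 6 * M by omega)
    rw [← hN] at h1
    nlinarith
  have : NeZero N := ⟨by omega⟩
  have hmain := Seg.card_mul_sq_le hlt
    (fun e he => hmem e _ (mem_consecutivePairs.1 (mem_consecutiveSegs.1 he).2).1)
    (fun e he => hmem e _ (mem_consecutivePairs.1 (mem_consecutiveSegs.1 he).2).2.1) hX hdisj N
  have h1 : E.card * N ^ 2 ≤ 2 * L.card ^ 2 := by
    have h2 : 3 * P.card * N ^ 3 ≤ 3 * M * N ^ 3 := by gcongr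
    have h3 : 6 * M * N * N ^ 2 ≤ E.card * N ^ 2 := Nat.mul_le_mul_right _ hN2
    have h4 : 6 * M * N * N ^ 2 = 2 * (3 * M * N ^ 3) := by ring
    omega
  have h2 : E.card ^ 3 ≤ 288 * M ^ 2 * L.card ^ 2 := by
    calc E.card ^ 3 = E.card * E.card ^ 2 := by ring
      _ ≤ E.card * (12 * M * N) ^ 2 := by gcongr
      _ = 144 * M ^ 2 * (E.card * N ^ 2) := by ring
      _ ≤ 144 * M ^ 2 * (2 * L.card ^ 2) := by gcongr
      _ = _ := by ring
  rcases Nat.eq_zero_or_pos L.card with h0 | h0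
  · simp [h0]
  refine Nat.le_of_mul_le_mul_right ?_ (Nat.pow_pos (n := 2) h0)
  calc L.card * k ^ 3 * L.card ^ 2 = (L.card * k) ^ 3 := by ring
    _ ≤ (2 * E.card) ^ 3 := by gcongr
    _ = 8 * E.card ^ 3 := by ring
    _ ≤ 8 * (288 * M ^ 2 * L.card ^ 2) := by gcongr
    _ = 2304 * 1 * M ^ 2 * L.card ^ 2 := by ring
    _ ≤ 2304 * D * M ^ 2 * L.card ^ 2 := by gcongr

end Incidences

section Lattice

/-- The cross product of `q - p` and `w - p`. -/
def cross (p q w : Pt) : ℤ := (q.1 - p.1) * (w.2 - p.2) - (q.2 - p.2) * (w.1 - p.1)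

lemma emb_injective : Function.Injective emb := by
  intro p q h
  simp only [emb, Prod.mk.injEq, Int.cast_inj] at h
  exact Prod.ext h.1 h.2

lemma emb_mem_lineThrough {p q w : Pt} (h : p ≠ q) :
    emb w ∈ lineThrough p q ↔ cross p q w = 0 := by
  have hc : cross p q w = 0 ↔ ((q.1 : ℝ) - p.1) * (w.2 - p.2) - (q.2 - p.2) * (w.1 - p.1) = 0 := by
    rw [cross]
    exact_mod_cast Iff.rfl
  rw [hc]
  simp only [lineThrough, emb, Set.mem_ofPred_eq, Prod.ext_iff, Prod.fst_add, Prod.snd_add,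
    Prod.smul_fst, Prod.smul_snd, Prod.fst_sub, Prod.snd_sub, smul_eq_mul]
  constructor
  · rintro ⟨t, h1, h2⟩
    rw [h1, h2]
    ring
  · intro h0
    by_cases h1 : (q.1 : ℝ) - p.1 = 0
    · have h2 : (q.2 : ℝ) - p.2 ≠ 0 := fun h2 => h (Prod.ext
        (by exact_mod_cast (sub_eq_zero.1 h1).symm) (by exact_mod_cast (sub_eq_zero.1 h2).symm))
      refine ⟨(w.2 - p.2) / (q.2 - p.2), ?_, ?_⟩
      · rw [h1] at h0 ⊢
        have h3 : ((q.2 : ℝ) - p.2) * (w.1 - p.1) = 0 := by linarith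
        have := (mul_eq_zero.1 h3).resolve_left h2
        linarith
      · field_simp
        ring
    · refine ⟨(w.1 - p.1) / (q.1 - p.1), ?_, ?_⟩
      · field_simp
        ring
      · field_simp
        linear_combination h0

lemma lineCount_lineThrough {p q : Pt} (h : p ≠ q) (S : Finset Pt) :
    lineCount (lineThrough p q) S = (S.filter fun w => cross p q w = 0).card := by
  have : lineThrough p q ∩ emb '' (S : Set Pt) =
      emb '' ((S.filter fun w => cross p q w = 0 : Finset Pt) : Set Pt) := by
    ext x
    constructor
    · rintro ⟨hx, w, hw, rfl⟩
      exact ⟨w, Finset.mem_coe.2 (Finset.mem_filter.2 ⟨hw, (emb_mem_lineThrough h).1 hx⟩), rfl⟩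
    · rintro ⟨w, hw, rfl⟩
      obtain ⟨hw, hx⟩ := Finset.mem_filter.1 (Finset.mem_coe.1 hw)
      exact ⟨(emb_mem_lineThrough h).2 hx, w, hw, rfl⟩
  rw [lineCount, this, Set.ncard_image_of_injective _ emb_injective, Set.ncard_coe_finset]

/-- The slope of the line through two lattice points. -/
def slopeOf (p q : Pt) : ℝ := ((q.2 : ℝ) - p.2) / (q.1 - p.1)

/-- The non-vertical line through `p` with slope `α`, as a pair (slope, intercept). -/
def lineAt (x : Pt × ℝ) : ℝ × ℝ := (x.2, x.1.2 - x.2 * x.1.1)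

lemma cross_eq_zero_iff {p q w : Pt} (h : q.1 ≠ p.1) :
    cross p q w = 0 ↔
      (w.2 : ℝ) = (lineAt (p, slopeOf p q)).1 * w.1 + (lineAt (p, slopeOf p q)).2 := by
  have hc : cross p q w = 0 ↔ ((q.1 : ℝ) - p.1) * (w.2 - p.2) - (q.2 - p.2) * (w.1 - p.1) = 0 := by
    rw [cross]
    exact_mod_cast Iff.rfl
  have h1 : (q.1 : ℝ) - p.1 ≠ 0 := sub_ne_zero.2 (by exact_mod_cast h)
  rw [hc]
  simp only [lineAt, slopeOf]
  field_simp
  constructor <;> intro h0 <;> linear_combination h0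

lemma card_pointsOn_lineAt {p q : Pt} (h : q.1 ≠ p.1) (S : Finset Pt) :
    (pointsOn (S.image emb) (lineAt (p, slopeOf p q))).card = lineCount (lineThrough p q) S := by
  rw [lineCount_lineThrough (fun hpq => h (by rw [hpq])), pointsOn, Finset.filter_image,
    Finset.card_image_of_injective _ emb_injective]
  congr 1
  refine Finset.filter_congr fun w _ => ?_
  rw [cross_eq_zero_iff h]
  rfl

/-- A right angle at `p ∈ S` with legs ending at `u ∈ U` and `v ∈ V`, the line `p u` containing
between `k` and `2 * k` points of `S`, at most `A` points of `U`, and the line `p v` containing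
at most `B` points of `V`. -/
structure IsRichAngle (S U V : Finset Pt) (k A B : ℕ) (p u v : Pt) : Prop where
  mem : p ∈ S
  mem_fst : u ∈ U
  mem_snd : v ∈ V
  ne_fst : p ≠ u
  ne_snd : p ≠ v
  dot : (p.1 - u.1) * (p.1 - v.1) + (p.2 - u.2) * (p.2 - v.2) = 0
  le_count : k ≤ lineCount (lineThrough p u) S
  count_le : lineCount (lineThrough p u) S ≤ 2 * k
  count_fst : lineCount (lineThrough u p) U ≤ A
  count_snd : lineCount (lineThrough v p) V ≤ B

variable {S U V : Finset Pt} {k A B : ℕ}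

lemma IsRichAngle.cross_snd {p u v u' v' : Pt} (h : IsRichAngle S U V k A B p u v)
    (h' : IsRichAngle S U V k A B p u' v') (hc : cross p u u' = 0) : cross v p v' = 0 := by
  have hpos : ∀ w : Pt, p ≠ w → (w.1 - p.1) ^ 2 + (w.2 - p.2) ^ 2 ≠ 0 := fun w hw h0 => by
    have h1 : w.1 - p.1 = 0 := by nlinarith [sq_nonneg (w.1 - p.1), sq_nonneg (w.2 - p.2)]
    have h2 : w.2 - p.2 = 0 := by nlinarith [sq_nonneg (w.1 - p.1), sq_nonneg (w.2 - p.2)]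
    exact hw (Prod.ext (by linarith) (by linarith))
  have key : ((u.1 - p.1) ^ 2 + (u.2 - p.2) ^ 2) *
      (((u'.1 - p.1) ^ 2 + (u'.2 - p.2) ^ 2) * cross v p v') = 0 := by
    have d := h.dot
    have d' := h'.dot
    unfold cross at *
    linear_combination
      -d * ((u'.1 - p.1) ^ 2 + (u'.2 - p.2) ^ 2) *
          ((u.1 - p.1) * (v'.2 - p.2) - (u.2 - p.2) * (v'.1 - p.1))
        + d' * ((u.1 - p.1) * (v.2 - p.2) - (u.2 - p.2) * (v.1 - p.1)) *
          ((u.1 - p.1) * (u'.1 - p.1) + (u.2 - p.2) * (u'.2 - p.2))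
        - hc * ((u.1 - p.1) * (v.2 - p.2) - (u.2 - p.2) * (v.1 - p.1)) *
          ((u'.1 - p.1) * (v'.2 - p.2) - (u'.2 - p.2) * (v'.1 - p.1))
  exact ((mul_eq_zero.1 ((mul_eq_zero.1 key).resolve_left (hpos u h.ne_fst))).resolve_left
    (hpos u' h'.ne_fst))

lemma card_richAngle_le_of_collinear {F : Finset (Pt × Pt × Pt)}
    (hF : ∀ t ∈ F, IsRichAngle S U V k A B t.1 t.2.1 t.2.2)
    (hcol : ∀ t ∈ F, ∀ t' ∈ F, t.1 = t'.1 ∧ cross t.1 t.2.1 t'.2.1 = 0) : F.card ≤ A * B := by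
  rcases F.eq_empty_or_nonempty with rfl | ⟨t, ht⟩
  · simp
  have h := hF t ht
  refine le_trans ?_ (Nat.mul_le_mul h.count_fst h.count_snd)
  rw [lineCount_lineThrough h.ne_fst.symm, lineCount_lineThrough h.ne_snd.symm,
    ← Finset.card_product]
  refine Finset.card_le_card_of_injOn Prod.snd (fun t' ht' => ?_) ?_
  · obtain ⟨h1, h2⟩ := hcol t ht t' ht'
    have h' := hF t' ht'
    rw [← h1] at h'
    refine Finset.mem_coe.2 (Finset.mem_product.2 ⟨Finset.mem_filter.2 ⟨h'.mem_fst, ?_⟩,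
      Finset.mem_filter.2 ⟨h'.mem_snd, h.cross_snd h' h2⟩⟩)
    unfold cross at *
    linear_combination -h2
  · intro t₁ h₁ t₂ h₂ he
    exact Prod.ext (hcol t₁ h₁ t₂ h₂).1 he

lemma card_richAngle_vertical_le {F : Finset (Pt × Pt × Pt)}
    (hF : ∀ t ∈ F, IsRichAngle S U V k A B t.1 t.2.1 t.2.2)
    (hv : ∀ t ∈ F, t.2.1.1 = t.1.1) : F.card ≤ A * B * S.card := by
  refine (Finset.card_le_mul_card_image (f := Prod.fst) F (A * B) fun p _ => ?_).trans
    (Nat.mul_le_mul_left _ (Finset.card_le_card fun p hp => ?_))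
  · refine card_richAngle_le_of_collinear (fun t ht => hF t (Finset.mem_filter.1 ht).1)
      fun t ht t' ht' => ?_
    obtain ⟨htF, rfl⟩ := Finset.mem_filter.1 ht
    obtain ⟨htF', h'⟩ := Finset.mem_filter.1 ht'
    refine ⟨h'.symm, ?_⟩
    have h1 := hv t htF
    have h2 := hv t' htF'
    rw [cross, h1, h2, h']
    ring
  · obtain ⟨t, ht, rfl⟩ := Finset.mem_image.1 hp
    exact (hF t ht).mem

lemma card_richAngle_nonvertical_mul_sq_le {F : Finset (Pt × Pt × Pt)} {M D : ℕ} (hk : 2 ≤ k)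
    (hS : S.card ≤ M) (hD : k ^ 2 ≤ D * M)
    (hF : ∀ t ∈ F, IsRichAngle S U V k A B t.1 t.2.1 t.2.2)
    (hv : ∀ t ∈ F, t.2.1.1 ≠ t.1.1) : F.card * k ^ 2 ≤ A * B * (4608 * D * M ^ 2) := by
  classical
  let K := F.image fun t => (t.1, slopeOf t.1 t.2.1)
  let L := K.image lineAt
  have h1 : F.card ≤ A * B * K.card := by
    refine Finset.card_le_mul_card_image F (A * B) fun p _ => ?_
    refine card_richAngle_le_of_collinear (fun t ht => hF t (Finset.mem_filter.1 ht).1)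
      fun t ht t' ht' => ?_
    obtain ⟨htF, rfl⟩ := Finset.mem_filter.1 ht
    obtain ⟨htF', h'⟩ := Finset.mem_filter.1 ht'
    have h2 : t'.1 = t.1 := (Prod.mk.inj h').1
    refine ⟨h2.symm, (cross_eq_zero_iff (hv t htF)).2 ?_⟩
    rw [← h', ← cross_eq_zero_iff (hv t' htF'), cross]
    ring
  have hL : ∀ ℓ ∈ L, k ≤ (pointsOn (S.image emb) ℓ).card ∧
      (pointsOn (S.image emb) ℓ).card ≤ 2 * k := fun ℓ hℓ => by
    obtain ⟨x, hx, rfl⟩ := Finset.mem_image.1 hℓ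
    obtain ⟨t, ht, rfl⟩ := Finset.mem_image.1 hx
    rw [card_pointsOn_lineAt (hv t ht)]
    exact ⟨(hF t ht).le_count, (hF t ht).count_le⟩
  have h2 : K.card ≤ 2 * k * L.card := by
    refine Finset.card_le_mul_card_image K (2 * k) fun ℓ hℓ => ?_
    refine le_trans (Finset.card_le_card_of_injOn (fun x => emb x.1) (fun x hx => ?_) ?_)
      (hL ℓ hℓ).2
    · obtain ⟨hxK, rfl⟩ := Finset.mem_filter.1 (Finset.mem_coe.1 hx)
      obtain ⟨t, ht, rfl⟩ := Finset.mem_image.1 hxK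
      refine Finset.mem_coe.2 (Finset.mem_filter.2
        ⟨Finset.mem_image_of_mem _ (hF t ht).mem, ?_⟩)
      simp only [lineAt, emb]
      ring
    · intro x hx y hy hxy
      have e1 := (Finset.mem_filter.1 (Finset.mem_coe.1 hx)).2
      have e2 := (Finset.mem_filter.1 (Finset.mem_coe.1 hy)).2
      exact Prod.ext (emb_injective hxy) (congrArg Prod.fst (e1.trans e2.symm))
  have h3 := card_rich_lines_mul_pow_three_le hk (fun ℓ hℓ => (hL ℓ hℓ).1)
    (Finset.card_image_le.trans hS) hD
  calc F.card * k ^ 2 ≤ A * B * (2 * k * L.card) * k ^ 2 := by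
        gcongr
        exact h1.trans (Nat.mul_le_mul_left _ h2)
    _ = A * B * (2 * (L.card * k ^ 3)) := by ring
    _ ≤ A * B * (2 * (2304 * D * M ^ 2)) := by gcongr
    _ = _ := by ring

theorem card_richAngle_mul_sq_le {F : Finset (Pt × Pt × Pt)} {M D : ℕ} (hk : 2 ≤ k)
    (hS : S.card ≤ M) (hD : k ^ 2 ≤ D * M)
    (hF : ∀ t ∈ F, IsRichAngle S U V k A B t.1 t.2.1 t.2.2) :
    F.card * k ^ 2 ≤ A * B * (4609 * D * M ^ 2) := by
  rw [← F.card_filter_add_card_filter_not (p := fun t => t.2.1.1 = t.1.1), add_mul]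
  have h1 := card_richAngle_vertical_le (F := F.filter fun t => t.2.1.1 = t.1.1)
    (fun t ht => hF t (Finset.mem_filter.1 ht).1) fun t ht => (Finset.mem_filter.1 ht).2
  have h2 := card_richAngle_nonvertical_mul_sq_le (F := F.filter fun t => ¬ t.2.1.1 = t.1.1)
    hk hS hD (fun t ht => hF t (Finset.mem_filter.1 ht).1) fun t ht => (Finset.mem_filter.1 ht).2
  refine (add_le_add (Nat.mul_le_mul h1 hD) h2).trans ?_
  calc A * B * S.card * (D * M) + A * B * (4608 * D * M ^ 2)
      ≤ A * B * M * (D * M) + A * B * (4608 * D * M ^ 2) := by gcongr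
    _ = _ := by ring

lemma finite_QZeroJA (S : ℕ → Finset Pt) (j a : Fin 4 → ℕ) : (QZeroJA S j a).Finite :=
  (Fintype.piFinset fun k => S (j k)).finite_toSet.subset fun Q hQ => by
    simpa using hQ.2.2.1

lemma IsPara.eq_of_three {Q Q' : Quad} (h : IsPara Q) (h' : IsPara Q') (h0 : Q 0 = Q' 0)
    (h1 : Q 1 = Q' 1) (h3 : Q 3 = Q' 3) : Q = Q' := by
  have h2 : Q 2 = Q' 2 := by
    unfold IsPara at h h'
    rw [h0, h1, h3, ← h'] at h
    exact add_left_cancel h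
  funext k
  fin_cases k <;> assumption

lemma ncard_QZeroJA_mul_sq_le {S : ℕ → Finset Pt} {j a : Fin 4 → ℕ} {D : ℕ} (ha : 1 ≤ a 0)
    (hS : (S (j 0)).card ≤ 2 ^ j 0) (hD : (2 ^ a 0) ^ 2 ≤ D * 2 ^ j 0) :
    (QZeroJA S j a).ncard * (2 ^ a 0) ^ 2 ≤
      2 * (2 ^ (a 1 + 1) * 2 ^ (a 3 + 1) * (4609 * D * (2 ^ j 0) ^ 2)) := by
  classical
  have hk : 2 ≤ 2 ^ a 0 := by simpa using Nat.pow_le_pow_right (n := 2) two_pos ha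
  obtain ⟨F, hF⟩ := (finite_QZeroJA S j a).exists_finset_coe
  rw [← hF, Set.ncard_coe_finset]
  have hmem : ∀ Q ∈ F, Q ∈ QZeroJA S j a := fun Q hQ => hF ▸ Finset.mem_coe.2 hQ
  let R : Quad → Prop := fun Q => 2 ^ a 0 ≤ lineCount (lineThrough (Q 0) (Q 1)) (S (j 0))
  have hinj1 : Set.InjOn (fun Q : Quad => (Q 0, Q 1, Q 3)) F := fun Q hQ Q' hQ' h => by
    simp only [Prod.mk.injEq] at h
    exact (hmem Q hQ).1.1.eq_of_three (hmem Q' hQ').1.1 h.1 h.2.1 h.2.2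
  have hinj2 : Set.InjOn (fun Q : Quad => (Q 0, Q 3, Q 1)) F := fun Q hQ Q' hQ' h => by
    simp only [Prod.mk.injEq] at h
    exact (hmem Q hQ).1.1.eq_of_three (hmem Q' hQ').1.1 h.1 h.2.2 h.2.1
  have h1 : (F.filter R).card * (2 ^ a 0) ^ 2 ≤
      2 ^ (a 1 + 1) * 2 ^ (a 3 + 1) * (4609 * D * (2 ^ j 0) ^ 2) := by
    rw [← Finset.card_image_of_injOn (hinj1.mono (Finset.coe_subset.2 (Finset.filter_subset _ _)))]
    refine card_richAngle_mul_sq_le (S := S (j 0)) (U := S (j 1)) (V := S (j 3)) hk hS hD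
      fun t ht => ?_
    obtain ⟨Q, hQ, rfl⟩ := Finset.mem_image.1 ht
    obtain ⟨hQF, hR⟩ := Finset.mem_filter.1 hQ
    obtain ⟨⟨-, hd⟩, hi, hm, hc⟩ := hmem Q hQF
    have c0 := (max_lt_iff.1 (hc 0).2).1
    have c1 := (max_lt_iff.1 (hc 1).2).2
    have c3 := (max_lt_iff.1 (hc 3).2).1
    exact ⟨hm 0, hm 1, hm 3, hi.ne (by decide), hi.ne (by decide), hd, hR,
      c0.le.trans_eq (pow_succ' _ _), c1.le, c3.le⟩
  have h2 : (F.filter fun Q => ¬ R Q).card * (2 ^ a 0) ^ 2 ≤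
      2 ^ (a 1 + 1) * 2 ^ (a 3 + 1) * (4609 * D * (2 ^ j 0) ^ 2) := by
    rw [← Finset.card_image_of_injOn (hinj2.mono (Finset.coe_subset.2 (Finset.filter_subset _ _))),
      mul_comm (2 ^ (a 1 + 1))]
    refine card_richAngle_mul_sq_le (S := S (j 0)) (U := S (j 3)) (V := S (j 1)) hk hS hD
      fun t ht => ?_
    obtain ⟨Q, hQ, rfl⟩ := Finset.mem_image.1 ht
    obtain ⟨hQF, hR⟩ := Finset.mem_filter.1 hQ
    obtain ⟨⟨-, hd⟩, hi, hm, hc⟩ := hmem Q hQF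
    have c0 := (max_lt_iff.1 (hc 0).2).2
    have c1 := (max_lt_iff.1 (hc 1).2).2
    have c3 := (max_lt_iff.1 (hc 3).2).1
    refine ⟨hm 0, hm 3, hm 1, hi.ne (by decide), hi.ne (by decide), ?_,
      (le_max_iff.1 (hc 0).1).resolve_left hR, c0.le.trans_eq (pow_succ' _ _), c3.le, c1.le⟩
    unfold dotQ at hd
    linear_combination hd
  rw [← F.card_filter_add_card_filter_not (p := R), add_mul, two_mul]
  exact add_le_add h1 h2

end Lattice

/-- **Estimate (3.9) of Lemma 3.5.** If `1 ≤ a₁ < j₁/2 + C` then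
`#𝒬⁰(j⃗,a⃗) ≲ 2^{2j₁ − 2a₁ + a₂ + a₄}`. -/
theorem QZeroJA_count_a2_a4 (C : ℕ) :
    ∃ c : ℝ, 0 < c ∧
      ∀ (m : ℕ) (S : ℕ → Finset Pt),
        1 ≤ m →
        (∀ i ≤ m, ∀ j ≤ m, i ≠ j → Disjoint (S i) (S j)) →
        (∀ j ≤ m, (S j).card ≤ 2 ^ j) →
        ∀ j a : Fin 4 → ℕ, (∀ k, j k ≤ m) →
          1 ≤ a 0 → (a 0 : ℝ) < (j 0 : ℝ) / 2 + (C : ℝ) →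
          ((QZeroJA S j a).ncard : ℝ) ≤
            c * (2 : ℝ) ^ (2 * (j 0 : ℝ) - 2 * (a 0 : ℝ) + (a 1 : ℝ) + (a 3 : ℝ)) := by
  refine ⟨8 * 4609 * 2 ^ (2 * C), by positivity, ?_⟩
  intro m S _ _ hS j a hj ha haC
  have hD : (2 ^ a 0) ^ 2 ≤ 2 ^ (2 * C) * 2 ^ j 0 := by
    rw [← pow_mul, ← pow_add]
    refine Nat.pow_le_pow_right two_pos ?_
    have : (a 0 * 2 : ℝ) ≤ 2 * C + j 0 := by linarith
    exact_mod_cast this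
  have h := ncard_QZeroJA_mul_sq_le ha (hS _ (hj 0)) hD
  have h' : ((QZeroJA S j a).ncard : ℝ) * (2 ^ a 0) ^ 2 ≤
      2 * (2 ^ (a 1 + 1) * 2 ^ (a 3 + 1) * (4609 * 2 ^ (2 * C) * (2 ^ j 0) ^ 2)) := by
    exact_mod_cast h
  have he : (2 : ℝ) ^ (2 * (j 0 : ℝ) - 2 * (a 0 : ℝ) + (a 1 : ℝ) + (a 3 : ℝ)) =
      (2 ^ j 0) ^ 2 / (2 ^ a 0) ^ 2 * 2 ^ a 1 * 2 ^ a 3 := by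
    rw [Real.rpow_add two_pos, Real.rpow_add two_pos, Real.rpow_sub two_pos, mul_comm (2 : ℝ) (j 0),
      mul_comm (2 : ℝ) (a 0), Real.rpow_mul zero_le_two, Real.rpow_mul zero_le_two]
    simp only [Real.rpow_natCast, Real.rpow_two]
  have hpos : (0 : ℝ) < (2 ^ a 0) ^ 2 := by positivity
  rw [he]
  refine ((le_div_iff₀ hpos).2 h').trans_eq ?_
  ring
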